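/- arXiv:2506.05291 — 2 statements merged into one kernel-verified Lean document; each statement's English description precedes it below -/
import Mathlib

section
/- Let H be a hypergroup with identity e, and let p and q be distinct involutions of H. Assume that p or q is a thick element of H, and that pq = {r} for some r ∈ H. Then r is not an involution of H. -/
namespace HyperPaper

/-- A hypergroup: hypermultiplication `hmul`, inversion `star`, identity `e`,
satisfying (H1) associativity, (H2) unique two-sided identity, (H3) exchange conditions. -/
structure Hypergroup (H : Type*) where
  hmul : H → H → Set H
  star : H → H
  e : H
  idl : ∀ p, hmul e p = {p}
  idr : ∀ p, hmul p e = {p}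
  e_unique : ∀ e' : H, (∀ p, hmul e' p = {p} ∧ hmul p e' = {p}) → e' = e
  assoc : ∀ p q r : H, (⋃ x ∈ hmul p q, hmul x r) = ⋃ x ∈ hmul q r, hmul p x
  h3l : ∀ p q r : H, p ∈ hmul q r ↔ q ∈ hmul p (star r)
  h3r : ∀ p q r : H, p ∈ hmul q r ↔ r ∈ hmul (star q) p

variable {H : Type*}

namespace Hypergroup

/-- Product of two subsets: FG = {a : ∃ b ∈ F, c ∈ G, a ∈ bc}. -/
def smul (hg : Hypergroup H) (F G : Set H) : Set H :=
  {a | ∃ b ∈ F, ∃ c ∈ G, a ∈ hg.hmul b c}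

/-- Closed subset: nonempty and G*G ⊆ G. -/
def IsClosed (hg : Hypergroup H) (G : Set H) : Prop :=
  G.Nonempty ∧ hg.smul (hg.star '' G) G ⊆ G

/-- Thin element: p*p = {e}. -/
def IsThin (hg : Hypergroup H) (p : H) : Prop := hg.hmul (hg.star p) p = {hg.e}

/-- Thick element: not thin. -/
def IsThick (hg : Hypergroup H) (p : H) : Prop := ¬ hg.IsThin p

/-- Involution: p ≠ e and {e, p} is closed. -/
def IsInvolution (hg : Hypergroup H) (p : H) : Prop :=
  p ≠ hg.e ∧ hg.IsClosed {hg.e, p}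

/-- ⟨G⟩: smallest closed subset containing G. -/
def gen (hg : Hypergroup H) (G : Set H) : Set H := ⋂₀ {C | hg.IsClosed C ∧ G ⊆ C}

/-- O_ϑ(G): the thin elements of H lying in G. -/
def Othin (hg : Hypergroup H) (G : Set H) : Set H := {p ∈ G | hg.IsThin p}

/-- F is a strongly normal closed subset of G: p*Fp ⊆ F ⊆ G for all p ∈ G. -/
def IsStronglyNormal (hg : Hypergroup H) (F G : Set H) : Prop :=
  hg.IsClosed F ∧ hg.IsClosed G ∧ F ⊆ G ∧
    ∀ p ∈ G, hg.smul (hg.smul {hg.star p} F) {p} ⊆ F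

/-- O^ϑ(G): intersection of all strongly normal closed subsets of ⟨G⟩. -/
def Osup (hg : Hypergroup H) (G : Set H) : Set H :=
  ⋂₀ {F | hg.IsStronglyNormal F (hg.gen G)}

/-- F is a normal closed subset of G. -/
def IsNormal (hg : Hypergroup H) (F G : Set H) : Prop :=
  hg.IsClosed F ∧ hg.IsClosed G ∧ F ⊆ G ∧ ∀ p ∈ G, hg.smul F {p} = hg.smul {p} F

/-- Product of a list of subsets (empty product is {e}). -/
def listProd (hg : Hypergroup H) : List (Set H) → Set H
  | [] => {hg.e}
  | a :: l => hg.smul a (hg.listProd l)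

/-- Product r_1 r_2 ⋯ r_n of a family of elements. -/
def famProd (hg : Hypergroup H) {n : ℕ} (r : Fin n → H) : Set H :=
  hg.listProd ((List.finRange n).map fun i => ({r i} : Set H))

/-- Ĝ_i: the product of the G_j with j ≠ i. -/
def cofactor (hg : Hypergroup H) {n : ℕ} (G : Fin n → Set H) (i : Fin n) : Set H :=
  hg.listProd (((List.finRange n).filter fun j => decide (j ≠ i)).map G)

/-- H is the direct product of the normal closed subsets G_1, …, G_n. -/
def IsDirectProduct (hg : Hypergroup H) {n : ℕ} (G : Fin n → Set H) : Prop :=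
  (∀ i, hg.IsNormal (G i) Set.univ) ∧
  (∀ i, hg.smul (G i) (hg.cofactor G i) = Set.univ) ∧
  (∀ i, G i ∩ hg.cofactor G i = {hg.e})

/-- r : Fin n → H is a decomposition of x with respect to the family G. -/
def IsDecomp (hg : Hypergroup H) {n : ℕ} (G : Fin n → Set H) (x : H) (r : Fin n → H) : Prop :=
  (∀ i, r i ∈ G i) ∧ x ∈ hg.famProd r

/-- The support of x: the elements ≠ e appearing in the decomposition of x. -/
def dsupport (hg : Hypergroup H) {n : ℕ} (G : Fin n → Set H) (x : H) : Set H :=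
  {y | y ≠ hg.e ∧ ∃ r, hg.IsDecomp G x r ∧ y ∈ Set.range r}

/-- The cover of x: the product r_1r_2⋯r_n for the decomposition of x. -/
def dcover (hg : Hypergroup H) {n : ℕ} (G : Fin n → Set H) (x : H) : Set H :=
  {y | ∃ r, hg.IsDecomp G x r ∧ y ∈ hg.famProd r}

/-- x is constrained: its cover equals {x}. -/
def IsConstrained (hg : Hypergroup H) {n : ℕ} (G : Fin n → Set H) (x : H) : Prop :=
  hg.dcover G x = {x}

/-- r_2(G): the largest 2-rank of a thin closed subset of H contained in G
(equivalently, the largest k such that G contains a thin symmetric closed subset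
of 2^k elements, which corresponds to an elementary abelian 2-group of 2-rank k). -/
noncomputable def rank2 (hg : Hypergroup H) (G : Set H) : ℕ :=
  sSup {k | ∃ U : Set H, hg.IsClosed U ∧ U ⊆ G ∧ (∀ u ∈ U, hg.IsThin u) ∧
    (∀ u ∈ U, hg.star u = u) ∧ U.ncard = 2 ^ k}

/-- F is a minimal generating subset of G. -/
def IsMinGen (hg : Hypergroup H) (G F : Set H) : Prop :=
  F ⊆ G ∧ hg.gen F = G ∧ ∀ p ∈ F, hg.gen (F \ {p}) ≠ G

/-- The dimension of G: the smallest cardinality of a minimal generating subset. -/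
noncomputable def dimension (hg : Hypergroup H) (G : Set H) : ℕ :=
  sInf {k | ∃ F : Set H, hg.IsMinGen G F ∧ F.Finite ∧ F.ncard = k}

/-- [F, G] = ⟨{a : ∃ b ∈ F, c ∈ G, a ∈ b*c*bc}⟩. -/
def commSet (hg : Hypergroup H) (F G : Set H) : Set H :=
  hg.gen {a | ∃ b ∈ F, ∃ c ∈ G,
    a ∈ hg.smul (hg.smul (hg.smul {hg.star b} {hg.star c}) {b}) {c}}

/-- derived G k = G^{(k+1)}: G^{(1)} = G, G^{(r)} = [G^{(r-1)}, G]. -/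
def derived (hg : Hypergroup H) (G : Set H) : ℕ → Set H
  | 0 => G
  | k + 1 => hg.commSet (hg.derived G k) G

/-- G is nilpotent: G^{(r)} = {e} for some r. -/
def IsNilpotent (hg : Hypergroup H) (G : Set H) : Prop :=
  ∃ k : ℕ, hg.derived G k = {hg.e}

/-- G is a residually thin closed subset: there is a chain {e} = F_1, …, F_n = G of
pairwise distinct closed subsets, each strongly normal in the next. -/
def IsResiduallyThin (hg : Hypergroup H) (G : Set H) : Prop :=
  ∃ (m : ℕ) (F : Fin (m + 1) → Set H), Function.Injective F ∧
    F 0 = {hg.e} ∧ F (Fin.last m) = G ∧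
    ∀ i : Fin m, hg.IsStronglyNormal (F i.castSucc) (F i.succ)

/-- x^k as a subset: x^0 = {e}, x^{k+1} = x^k · x. -/
def spow (hg : Hypergroup H) (x : H) : ℕ → Set H
  | 0 => {hg.e}
  | k + 1 => hg.smul (hg.spow x k) {x}

/-- F is a maximal closed subset of G. -/
def IsMaximalClosed (hg : Hypergroup H) (F G : Set H) : Prop :=
  hg.IsClosed F ∧ hg.IsClosed G ∧ F ⊆ G ∧ F ≠ G ∧
    ∀ E : Set H, hg.IsClosed E → F ⊆ E → E ⊆ G → E = F ∨ E = G

/-- The Frattini closed subset of G: the intersection (inside G) of all maximal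
closed subsets of G. -/
def frattini (hg : Hypergroup H) (G : Set H) : Set H :=
  G ∩ ⋂₀ {F | hg.IsMaximalClosed F G}

/-- α is an isomorphism from the closed subset F to the closed subset G. -/
def IsIso (hg : Hypergroup H) (F G : Set H) (α : H → H) : Prop :=
  Set.BijOn α F G ∧ α hg.e = hg.e ∧
    ∀ p ∈ F, ∀ q ∈ F, α '' hg.hmul p q = hg.hmul (α p) (α q)

/-- F ≃ G: there is an isomorphism from F to G. -/
def Isomorphic (hg : Hypergroup H) (F G : Set H) : Prop := ∃ α : H → H, hg.IsIso F G α

/-- Aut(G): the automorphism group of G, realized as the subgroup of permutations of G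
that fix e and preserve the hypermultiplication. -/
def autGroup (hg : Hypergroup H) (G : Set H) : Subgroup (Equiv.Perm G) where
  carrier := {σ | (∀ x : G, (x : H) = hg.e → ((σ x : H)) = hg.e) ∧
    ∀ p q x : G, (x : H) ∈ hg.hmul p q ↔ ((σ x : H)) ∈ hg.hmul (σ p) (σ q)}
  one_mem' := by
    constructor
    · intro x hx; simpa using hx
    · intro p q x; simp
  mul_mem' := by
    rintro σ τ ⟨he1, hm1⟩ ⟨he2, hm2⟩
    refine ⟨fun x hx => ?_, fun p q x => ?_⟩
    · simpa using he1 _ (he2 x hx)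
    · simpa using (hm2 p q x).trans (hm1 (τ p) (τ q) (τ x))
  inv_mem' := by
    rintro σ ⟨he, hm⟩
    refine ⟨fun x hx => ?_, fun p q x => ?_⟩
    · have h2 : σ x = x := Subtype.ext ((he x hx).trans hx.symm)
      have h3 : σ⁻¹ x = x := by
        conv_lhs => rw [← h2]
        simp
      rw [h3]; exact hx
    · have h := hm (σ⁻¹ p) (σ⁻¹ q) (σ⁻¹ x)
      simpa using h.symm

end Hypergroup

/-- An elementary abelian 2-hypergroup: a hypergroup that is the constrained direct
product of the closed subsets ⟨q_1⟩, …, ⟨q_n⟩ generated by involutions q_1, …, q_n. -/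
structure EA2Data (H : Type*) where
  hg : Hypergroup H
  n : ℕ
  q : Fin n → H
  invol : ∀ i, hg.IsInvolution (q i)
  dp : hg.IsDirectProduct fun i => hg.gen {q i}
  constrained : ∀ x : H, hg.IsConstrained (fun i => hg.gen {q i}) x

namespace EA2Data

/-- The family ⟨q_1⟩, …, ⟨q_n⟩. -/
def fam (E : EA2Data H) : Fin E.n → Set H := fun i => E.hg.gen {E.q i}

/-- The support of x. -/
def support (E : EA2Data H) (x : H) : Set H := E.hg.dsupport E.fam x

/-- Thick(F): externally thick elements of H lying in F. -/
def ThickIn (E : EA2Data H) (F : Set H) : Set H :=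
  {x ∈ F | x = E.hg.e ∨ ∀ y ∈ E.support x, E.hg.IsThick y}

/-- Thin(F): externally thin elements of H lying in F. -/
def ThinIn (E : EA2Data H) (F : Set H) : Set H :=
  {x ∈ F | x = E.hg.e ∨ ∀ y ∈ E.support x, E.hg.IsThin y}

/-- The (unique) pair (x⁺, x⁻) with x⁺ ∈ Thick(H), x⁻ ∈ Thin(H), x⁺x⁻ = {x}. -/
noncomputable def pm (E : EA2Data H) (x : H) : H × H :=
  @Classical.epsilon (H × H) ⟨(E.hg.e, E.hg.e)⟩ fun z =>
    z.1 ∈ E.ThickIn Set.univ ∧ z.2 ∈ E.ThinIn Set.univ ∧ E.hg.hmul z.1 z.2 = {x}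

/-- x⁺. -/
noncomputable def plus (E : EA2Data H) (x : H) : H := (E.pm x).1

/-- x⁻. -/
noncomputable def minus (E : EA2Data H) (x : H) : H := (E.pm x).2

/-- s(x): the number of thick elements of H in the support of x. -/
noncomputable def sElem (E : EA2Data H) (x : H) : ℕ :=
  {y ∈ E.support x | E.hg.IsThick y}.ncard

/-- s(G) = max {s(a) : a ∈ G}. -/
noncomputable def sSet (E : EA2Data H) (G : Set H) : ℕ :=
  sSup {k | ∃ a ∈ G, E.sElem a = k}

/-- x ⪯ y: the support of x is contained in the support of y. -/
def ple (E : EA2Data H) (x y : H) : Prop := E.support x ⊆ E.support y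

/-- p♯: the number of thick elements among q_1, …, q_n. -/
noncomputable def psharp (E : EA2Data H) : ℕ := {i : Fin E.n | E.hg.IsThick (E.q i)}.ncard

end EA2Data

/-- The Gaussian binomial coefficient C(n, k)_2 with base 2, via the
q-Pascal recurrence C(n, k)_2 = C(n-1, k-1)_2 + 2^k · C(n-1, k)_2. -/
def gaussBinom2 : ℕ → ℕ → ℕ
  | _, 0 => 1
  | 0, _ + 1 => 0
  | n + 1, k + 1 => gaussBinom2 n k + 2 ^ (k + 1) * gaussBinom2 n (k + 1)

end HyperPaper

open HyperPaper

namespace HyperPaper.Hypergroup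

variable {H : Type*} (hg : Hypergroup H)

theorem star_e : hg.star hg.e = hg.e := by
  have h : hg.e ∈ hg.hmul (hg.star hg.e) hg.e :=
    (hg.h3r _ _ _).1 (by rw [hg.idl]; rfl)
  rw [hg.idr] at h
  exact h.symm

theorem star_star (x : H) : hg.star (hg.star x) = x := by
  have h₁ : hg.e ∈ hg.hmul x (hg.star x) := (hg.h3l _ _ _).1 (by rw [hg.idl]; rfl)
  have h₂ : x ∈ hg.hmul hg.e (hg.star (hg.star x)) := (hg.h3l _ _ _).1 h₁
  rw [hg.idl] at h₂
  exact h₂.symm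

theorem e_mem_star_hmul_self (x : H) : hg.e ∈ hg.hmul (hg.star x) x :=
  (hg.h3r _ _ _).1 (by rw [hg.idr]; rfl)

variable {hg} {x : H}

theorem IsInvolution.star_eq (hx : hg.IsInvolution x) : hg.star x = x := by
  have h : hg.star x ∈ ({hg.e, x} : Set H) :=
    hx.2.2 ⟨hg.star x, ⟨x, Or.inr rfl, rfl⟩, hg.e, Or.inl rfl, by rw [hg.idr]; rfl⟩
  rcases h with h | h
  · exact absurd (by rw [← hg.star_star x, h, hg.star_e]) hx.1
  · exact h

theorem IsInvolution.eq_of_mem_hmul_self (hx : hg.IsInvolution x) {y : H}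
    (hy : y ∈ hg.hmul x x) (hye : y ≠ hg.e) : y = x := by
  have h : y ∈ ({hg.e, x} : Set H) :=
    hx.2.2 ⟨x, ⟨x, Or.inr rfl, hx.star_eq⟩, x, Or.inr rfl, hy⟩
  exact h.resolve_left hye

theorem IsInvolution.mem_hmul_self_of_isThick (hx : hg.IsInvolution x) (ht : hg.IsThick x) :
    x ∈ hg.hmul x x := by
  by_contra hn
  refine ht (Set.eq_singleton_iff_unique_mem.2 ⟨hg.e_mem_star_hmul_self x, fun y hy => ?_⟩)
  rw [hx.star_eq] at hy
  by_contra hye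
  exact hn (hx.eq_of_mem_hmul_self hy hye ▸ hy)

theorem IsInvolution.left_eq_of_mem_hmul (hx : hg.IsInvolution x) {y : H}
    (hy : x ∈ hg.hmul y x) (hye : y ≠ hg.e) : y = x :=
  hx.eq_of_mem_hmul_self (by simpa only [hx.star_eq] using (hg.h3l _ _ _).1 hy) hye

theorem IsInvolution.right_eq_of_mem_hmul (hx : hg.IsInvolution x) {y : H}
    (hy : x ∈ hg.hmul x y) (hye : y ≠ hg.e) : y = x :=
  hx.eq_of_mem_hmul_self (by simpa only [hx.star_eq] using (hg.h3r _ _ _).1 hy) hye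

end HyperPaper.Hypergroup

/-- If p and q are distinct involutions of a hypergroup H, at least one
of them thick, and pq = {r}, then r is not an involution of H. -/
theorem stmt0 {H : Type*} (hg : Hypergroup H) (p q : H)
    (hp : hg.IsInvolution p) (hq : hg.IsInvolution q) (hpq : p ≠ q)
    (hthick : hg.IsThick p ∨ hg.IsThick q) (r : H) (hr : hg.hmul p q = {r}) :
    ¬ hg.IsInvolution r := by
  intro hri
  have hrpq : r ∈ hg.hmul p q := hr ▸ rfl
  have hassoc_left := hg.assoc p p q
  have hassoc_right := hg.assoc p q q
  simp only [hr, Set.mem_singleton_iff, Set.iUnion_iUnion_eq_left] at hassoc_left hassoc_right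
  rcases hthick with ht | ht
  · have hmem : r ∈ hg.hmul p r := by
      rw [← hassoc_left]
      exact Set.mem_biUnion (hp.mem_hmul_self_of_isThick ht) hrpq
    obtain rfl := hri.left_eq_of_mem_hmul hmem hp.1
    exact hpq (hp.right_eq_of_mem_hmul hrpq hq.1).symm
  · have hmem : r ∈ hg.hmul r q := by
      rw [hassoc_right]
      exact Set.mem_biUnion (hq.mem_hmul_self_of_isThick ht) hrpq
    obtain rfl := hri.right_eq_of_mem_hmul hmem hq.1
    exact hpq (hq.left_eq_of_mem_hmul hrpq hp.1)
end

section
/- Let H be an elementary abelian 2-hypergroup and G a closed subset of H. Then Thick(G) and Thin(G) are closed subsets of H, and |G| = |Thick(G)·Thin(G)| = |Thick(G)|·|Thin(G)|. -/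
open HyperPaper

namespace HyperPaper

namespace Hypergroup

variable {H : Type*} (hg : Hypergroup H)

/-- The subsets of `H`, regarded as a monoid under the complex product of `hg`. -/
def Complexes {H : Type*} (_ : Hypergroup H) : Type _ := Set H

instance : SetLike hg.Complexes H := ⟨fun A => A, fun _ _ h => h⟩

/-- The singleton `{p}` as an element of the complex monoid. -/
def single (p : H) : hg.Complexes := ({p} : Set H)

@[simp] lemma mem_single {p x : H} : x ∈ hg.single p ↔ x = p := Iff.rfl

lemma smul_assoc (A B C : Set H) :
    hg.smul (hg.smul A B) C = hg.smul A (hg.smul B C) := by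
  ext x
  constructor
  · rintro ⟨y, ⟨a, ha, b, hb, hy⟩, c, hc, hx⟩
    have h : x ∈ ⋃ y ∈ hg.hmul a b, hg.hmul y c := Set.mem_biUnion hy hx
    rw [hg.assoc] at h
    obtain ⟨z, hz, hxz⟩ := Set.mem_iUnion₂.1 h
    exact ⟨a, ha, z, ⟨b, hb, c, hc, hz⟩, hxz⟩
  · rintro ⟨a, ha, y, ⟨b, hb, c, hc, hy⟩, hx⟩
    have h : x ∈ ⋃ y ∈ hg.hmul b c, hg.hmul a y := Set.mem_biUnion hy hx
    rw [← hg.assoc] at h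
    obtain ⟨z, hz, hxz⟩ := Set.mem_iUnion₂.1 h
    exact ⟨z, ⟨a, ha, b, hb, hz⟩, c, hc, hxz⟩

lemma one_smul (A : Set H) : hg.smul {hg.e} A = A := by
  ext x; simp [smul, hg.idl]

lemma smul_one (A : Set H) : hg.smul A {hg.e} = A := by
  ext x; simp [smul, hg.idr]

instance : Monoid hg.Complexes where
  mul A B := hg.smul A B
  one := ({hg.e} : Set H)
  mul_assoc := hg.smul_assoc
  one_mul := hg.one_smul
  mul_one := hg.smul_one

lemma mem_mul {A B : hg.Complexes} {x : H} :
    x ∈ A * B ↔ ∃ b ∈ A, ∃ c ∈ B, x ∈ hg.hmul b c := Iff.rfl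

@[simp] lemma mem_one {x : H} : x ∈ (1 : hg.Complexes) ↔ x = hg.e := Iff.rfl

lemma mem_single_mul_single {p q x : H} :
    x ∈ hg.single p * hg.single q ↔ x ∈ hg.hmul p q := by
  simp [mem_mul]

lemma single_e : hg.single hg.e = 1 := rfl

lemma listProd_eq (l : List (Set H)) :
    hg.listProd l = (List.prod (α := hg.Complexes) l : hg.Complexes) := by
  induction l with
  | nil => rfl
  | cons a l ih => rw [listProd, ih]; rfl

lemma famProd_eq {n : ℕ} (r : Fin n → H) :
    hg.famProd r = ((List.finRange n).map fun i => hg.single (r i)).prod :=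
  hg.listProd_eq _

lemma single_commute_iff {p q : H} :
    Commute (hg.single p) (hg.single q) ↔ hg.hmul p q = hg.hmul q p := by
  rw [commute_iff_eq, SetLike.ext_iff, Set.ext_iff]
  simp only [mem_single_mul_single]

lemma hmul_nonempty (p q : H) : (hg.hmul p q).Nonempty := by
  have he : hg.e ∈ hg.hmul q (hg.star q) := (hg.h3l q hg.e q).1 (by simp [hg.idl])
  have h : p ∈ ⋃ x ∈ hg.hmul q (hg.star q), hg.hmul p x :=
    Set.mem_biUnion he (by simp [hg.idr])
  rw [← hg.assoc] at h
  obtain ⟨x, hx, -⟩ := Set.mem_iUnion₂.1 h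
  exact ⟨x, hx⟩

variable {hg}

lemma e_mem_star_mul (p : H) : hg.e ∈ hg.hmul (hg.star p) p :=
  (hg.h3r p p hg.e).1 (by simp [hg.idr])

lemma eq_star_of_e_mem {p q : H} (h : hg.e ∈ hg.hmul p q) : p = hg.star q := by
  simpa [hg.idl] using (hg.h3l hg.e p q).1 h

lemma IsClosed.e_mem {G : Set H} (hG : hg.IsClosed G) : hg.e ∈ G := by
  obtain ⟨⟨p, hp⟩, h⟩ := hG
  exact h ⟨_, ⟨p, hp, rfl⟩, p, hp, e_mem_star_mul p⟩

lemma IsInvolution.star_eq_s3 {q : H} (hq : hg.IsInvolution q) : hg.star q = q := by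
  have h : hg.star q ∈ ({hg.e, q} : Set H) :=
    hq.2.2 ⟨_, ⟨q, by simp, rfl⟩, hg.e, by simp, by simp [hg.idr]⟩
  rcases h with h | h
  · have h2 := e_mem_star_mul (hg := hg) q
    rw [h, hg.idl] at h2
    exact absurd (Set.mem_singleton_iff.1 h2).symm hq.1
  · exact h

lemma IsInvolution.e_mem_hmul {q : H} (hq : hg.IsInvolution q) : hg.e ∈ hg.hmul q q := by
  simpa [hq.star_eq_s3] using e_mem_star_mul (hg := hg) q

lemma IsInvolution.hmul_subset {q : H} (hq : hg.IsInvolution q) :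
    hg.hmul q q ⊆ {hg.e, q} := fun x hx =>
  hq.2.2 ⟨q, ⟨q, by simp, hq.star_eq_s3⟩, q, by simp, hx⟩

lemma IsInvolution.isThick_iff {q : H} (hq : hg.IsInvolution q) :
    hg.IsThick q ↔ q ∈ hg.hmul q q := by
  rw [IsThick, IsThin, hq.star_eq_s3, not_iff_comm]
  constructor
  · intro h
    ext x
    constructor
    · intro hx
      rcases hq.hmul_subset hx with rfl | rfl
      · rfl
      · exact absurd hx h
    · rintro rfl
      exact hq.e_mem_hmul
  · intro h h2
    rw [h] at h2
    exact hq.1 h2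

lemma IsInvolution.gen_eq {q : H} (hq : hg.IsInvolution q) : hg.gen {q} = {hg.e, q} := by
  apply Set.Subset.antisymm
  · exact Set.sInter_subset_of_mem ⟨hq.2, by simp⟩
  · rintro x (rfl | rfl) C ⟨hC, hqC⟩
    · exact hC.e_mem
    · exact hqC rfl

lemma e_mem_listProd {l : List (Set H)} (he : ∀ A ∈ l, hg.e ∈ A) : hg.e ∈ hg.listProd l := by
  induction l with
  | nil => rfl
  | cons a l ih =>
    exact ⟨hg.e, he a (by simp), hg.e, ih fun A hA => he A (by simp [hA]), by simp [hg.idl]⟩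

lemma subset_listProd {l : List (Set H)} (he : ∀ A ∈ l, hg.e ∈ A) {A : Set H} (hA : A ∈ l) :
    A ⊆ hg.listProd l := by
  induction l with
  | nil => simp at hA
  | cons a l ih =>
    intro x hx
    have hl : ∀ B ∈ l, hg.e ∈ B := fun B hB => he B (by simp [hB])
    rcases List.mem_cons.1 hA with rfl | hA
    · exact ⟨x, hx, hg.e, e_mem_listProd hl, by simp [hg.idr]⟩
    · exact ⟨hg.e, he a (by simp), x, ih hl hA hx, by simp [hg.idl]⟩

end Hypergroup

namespace EA2Data

open Hypergroup

variable {H : Type*} (E : EA2Data H)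

lemma mem_fam {i : Fin E.n} {x : H} : x ∈ E.fam i ↔ x = E.hg.e ∨ x = E.q i := by
  rw [fam, (E.invol i).gen_eq]; rfl

lemma fam_inter_cofactor (i : Fin E.n) : E.fam i ∩ E.hg.cofactor E.fam i = {E.hg.e} :=
  E.dp.2.2 i

lemma q_notMem_fam {i j : Fin E.n} (hij : i ≠ j) : E.q i ∉ E.fam j := by
  intro h
  have hc : E.q i ∈ E.hg.cofactor E.fam i := by
    refine subset_listProd ?_ ?_ h
    · intro A hA
      obtain ⟨k, -, rfl⟩ := List.mem_map.1 hA
      exact E.mem_fam.2 (Or.inl rfl)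
    · exact List.mem_map.2 ⟨j, by simp [hij.symm], rfl⟩
  have : E.q i ∈ ({E.hg.e} : Set H) :=
    E.fam_inter_cofactor i ▸ ⟨E.mem_fam.2 (Or.inr rfl), hc⟩
  exact (E.invol i).1 this

lemma hmul_q_subset {i j : Fin E.n} (hij : i ≠ j) :
    E.hg.hmul (E.q i) (E.q j) ⊆ E.hg.hmul (E.q j) (E.q i) := by
  intro a ha
  have h1 : a ∈ E.hg.smul (E.fam i) {E.q j} :=
    ⟨E.q i, E.mem_fam.2 (Or.inr rfl), E.q j, rfl, ha⟩
  have hn : E.hg.smul (E.fam i) {E.q j} = E.hg.smul {E.q j} (E.fam i) :=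
    (E.dp.1 i).2.2.2 (E.q j) (Set.mem_univ _)
  rw [hn] at h1
  obtain ⟨_, rfl, c, hc, hac⟩ := h1
  rcases E.mem_fam.1 hc with rfl | rfl
  · rw [E.hg.idr, Set.mem_singleton_iff] at hac
    subst hac
    have h2 := (E.hg.h3l _ _ _).1 ha
    rw [(E.invol j).star_eq_s3] at h2
    exact absurd (E.mem_fam.2 ((E.invol j).hmul_subset h2)) (E.q_notMem_fam hij)
  · exact hac

lemma commute_q (i j : Fin E.n) : Commute (E.hg.single (E.q i)) (E.hg.single (E.q j)) := by
  rcases eq_or_ne i j with rfl | hij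
  · exact Commute.refl _
  · rw [single_commute_iff]
    exact (E.hmul_q_subset hij).antisymm (E.hmul_q_subset hij.symm)

lemma exists_decomp (x : H) : ∃ r, E.hg.IsDecomp E.fam x r := by
  have h : E.hg.dcover E.fam x = {x} := E.constrained x
  have hx : x ∈ E.hg.dcover E.fam x := by rw [h]; rfl
  obtain ⟨r, hr, -⟩ := hx
  exact ⟨r, hr⟩

lemma famProd_eq_of_isDecomp {x : H} {r : Fin E.n → H} (hr : E.hg.IsDecomp E.fam x r) :
    E.hg.famProd r = {x} := by
  have h : E.hg.dcover E.fam x = {x} := E.constrained x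
  refine Set.Subset.antisymm (fun y hy => ?_) (Set.singleton_subset_iff.2 hr.2)
  rw [← h]
  exact ⟨r, hr, hy⟩

lemma exists_single_eq (x : H) : ∃ r : Fin E.n → H, (∀ i, r i ∈ E.fam i) ∧
    E.hg.single x = ((List.finRange E.n).map fun i => E.hg.single (r i)).prod := by
  obtain ⟨r, hr⟩ := E.exists_decomp x
  refine ⟨r, hr.1, ?_⟩
  rw [← famProd_eq, E.famProd_eq_of_isDecomp hr]
  rfl

lemma hmul_comm (x y : H) : E.hg.hmul x y = E.hg.hmul y x := by
  have aux : ∀ (A : E.hg.Complexes), (∀ i, Commute A (E.hg.single (E.q i))) →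
      ∀ z, Commute A (E.hg.single z) := by
    intro A hA z
    obtain ⟨r, hr, hz⟩ := E.exists_single_eq z
    rw [hz]
    refine Commute.list_prod_right _ _ fun B hB => ?_
    obtain ⟨i, -, rfl⟩ := List.mem_map.1 hB
    rcases E.mem_fam.1 (hr i) with h | h <;> rw [h]
    · exact Commute.one_right A
    · exact hA i
  rw [← single_commute_iff]
  exact aux _ (fun i => (aux _ (E.commute_q i) x).symm) y

instance : CommMonoid E.hg.Complexes where
  mul_comm A B := by
    refine SetLike.ext fun x => ?_
    simp only [mem_mul]
    constructor <;> rintro ⟨b, hb, c, hc, h⟩ <;> exact ⟨c, hc, b, hb, E.hmul_comm b c ▸ h⟩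

lemma famProd_eq_prod (r : Fin E.n → H) : E.hg.famProd r = ∏ i, E.hg.single (r i) := by
  rw [famProd_eq, ← Fin.prod_univ_def]

lemma cofactor_eq_prod (i : Fin E.n) :
    E.hg.cofactor E.fam i =
      (∏ j ∈ Finset.univ.erase i, (E.fam j : E.hg.Complexes) : E.hg.Complexes) := by
  have h : Finset.univ.erase i = ((List.finRange E.n).filter fun j => decide (j ≠ i)).toFinset := by
    ext j; simp
  rw [cofactor, listProd_eq, h]
  exact (List.prod_toFinset (M := E.hg.Complexes) E.fam ((List.nodup_finRange _).filter _)).symm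

variable {E} in
lemma mem_prod {ι : Type*} [DecidableEq ι] {s : Finset ι} {A : ι → E.hg.Complexes} {x : H} :
    x ∈ ∏ i ∈ s, A i ↔ ∃ r : ι → H, (∀ i ∈ s, r i ∈ A i) ∧ x ∈ ∏ i ∈ s, E.hg.single (r i) := by
  induction s using Finset.induction_on generalizing x with
  | empty =>
    simp only [Finset.prod_empty, mem_one]
    exact ⟨fun h => ⟨fun _ => x, by simp, h⟩, fun ⟨_, _, h⟩ => h⟩
  | insert a s ha ih =>
    simp only [Finset.prod_insert ha, mem_mul, ih]
    constructor
    · rintro ⟨b, hb, c, ⟨r, hr, hc⟩, hx⟩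
      have hne : ∀ i ∈ s, Function.update r a b i = r i := fun i hi =>
        Function.update_of_ne (ne_of_mem_of_not_mem hi ha) _ _
      refine ⟨Function.update r a b, ?_, b, by simp, c, ?_, hx⟩
      · intro i hi
        rcases Finset.mem_insert.1 hi with rfl | hi
        · simpa using hb
        · rw [hne i hi]; exact hr i hi
      · rwa [Finset.prod_congr rfl fun i hi => by rw [hne i hi]]
    · rintro ⟨r, hr, b, hb, c, hc, hx⟩
      rw [mem_single] at hb
      subst hb
      exact ⟨r a, hr a (by simp), c, ⟨r, fun i hi => hr i (by simp [hi]), hc⟩, hx⟩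

open Classical in
/-- The family with value `q i` at the indices in `S` and `e` elsewhere. -/
noncomputable def rep (S : Finset (Fin E.n)) (i : Fin E.n) : H :=
  if i ∈ S then E.q i else E.hg.e

lemma rep_mem_fam (S : Finset (Fin E.n)) (i : Fin E.n) : E.rep S i ∈ E.fam i := by
  rw [mem_fam, rep]; split <;> simp

open Classical in
variable {E} in
lemma exists_rep_eq {r : Fin E.n → H} (hr : ∀ i, r i ∈ E.fam i) : ∃ S, r = E.rep S := by
  refine ⟨Finset.univ.filter fun i => r i = E.q i, funext fun i => ?_⟩
  rcases E.mem_fam.1 (hr i) with h | h <;> simp [rep, h]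

lemma rep_eq_q_iff {S : Finset (Fin E.n)} {i : Fin E.n} : E.rep S i = E.q i ↔ i ∈ S := by
  unfold rep; split <;> simp_all [(E.invol i).1.symm]

variable {E} in
lemma rep_mem_hmul {S T U : Finset (Fin E.n)} {i : Fin E.n} :
    E.rep U i ∈ E.hg.hmul (E.rep S i) (E.rep T i) ↔
      (i ∈ U → (i ∈ S ∨ i ∈ T) ∧ (i ∈ S → i ∈ T → E.hg.IsThick (E.q i))) ∧
        (i ∉ U → (i ∈ S ↔ i ∈ T)) := by
  have h1 := (E.invol i).1
  have h2 := (E.invol i).e_mem_hmul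
  rw [(E.invol i).isThick_iff]
  by_cases hU : i ∈ U <;> by_cases hS : i ∈ S <;> by_cases hT : i ∈ T <;>
    simp [rep, hU, hS, hT, E.hg.idl, E.hg.idr, h1, h1.symm, h2]

lemma exists_prod_rep (S : Finset (Fin E.n)) :
    ∃ x, ∏ i, E.hg.single (E.rep S i) = E.hg.single x := by
  have hne : ∀ s : Finset (Fin E.n), ∃ x, x ∈ ∏ i ∈ s, E.hg.single (E.rep S i) := by
    intro s
    induction s using Finset.induction_on with
    | empty => exact ⟨E.hg.e, rfl⟩
    | insert a s ha ih =>
      obtain ⟨c, hc⟩ := ih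
      obtain ⟨x, hx⟩ := E.hg.hmul_nonempty (E.rep S a) c
      rw [Finset.prod_insert ha]
      exact ⟨x, _, rfl, c, hc, hx⟩
  obtain ⟨x, hx⟩ := hne Finset.univ
  refine ⟨x, ?_⟩
  have h : E.hg.famProd (E.rep S) = {x} :=
    E.famProd_eq_of_isDecomp ⟨E.rep_mem_fam S, by rwa [famProd_eq_prod]⟩
  rw [famProd_eq_prod] at h
  exact SetLike.coe_injective h

/-- The unique element of the product of the `q i` with `i ∈ S`. -/
noncomputable def elt (S : Finset (Fin E.n)) : H := (E.exists_prod_rep S).choose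

lemma prod_rep (S : Finset (Fin E.n)) :
    ∏ i, E.hg.single (E.rep S i) = E.hg.single (E.elt S) := (E.exists_prod_rep S).choose_spec

lemma elt_surjective : Function.Surjective E.elt := by
  intro x
  obtain ⟨r, hr⟩ := E.exists_decomp x
  obtain ⟨S, rfl⟩ := exists_rep_eq hr.1
  have h := hr.2
  rw [famProd_eq_prod, prod_rep] at h
  exact ⟨S, Eq.symm h⟩

lemma single_elt_mul_single_elt (S T : Finset (Fin E.n)) :
    E.hg.single (E.elt S) * E.hg.single (E.elt T) =
      ∏ i, (E.hg.single (E.rep S i) * E.hg.single (E.rep T i)) := by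
  rw [← prod_rep, ← prod_rep, Finset.prod_mul_distrib]

lemma elt_empty : E.elt ∅ = E.hg.e := by
  have h := E.prod_rep ∅
  simp only [rep, Finset.notMem_empty, if_false, single_e, Finset.prod_const_one] at h
  exact (mem_single _).1 (h ▸ rfl : E.hg.e ∈ E.hg.single (E.elt ∅)) |>.symm

lemma e_mem_hmul_self (x : H) : E.hg.e ∈ E.hg.hmul x x := by
  obtain ⟨S, rfl⟩ := E.elt_surjective x
  rw [← mem_single_mul_single, single_elt_mul_single_elt, mem_prod]
  refine ⟨fun _ => E.hg.e, fun i _ => ?_, by simp [single_e]⟩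
  rw [mem_single_mul_single, rep]
  split
  · exact (E.invol i).e_mem_hmul
  · simp [E.hg.idl]

lemma star_eq_s3 (x : H) : E.hg.star x = x := (eq_star_of_e_mem (E.e_mem_hmul_self x)).symm

variable {E} in
lemma subset_of_elt_eq {S T : Finset (Fin E.n)} (h : E.elt S = E.elt T) : S ⊆ T := by
  intro i hS
  by_contra hT
  have hS' : E.hg.single (E.elt S) =
      E.hg.single (E.q i) * E.hg.single (E.elt (S.erase i)) := by
    rw [← prod_rep, ← prod_rep, ← Finset.mul_prod_erase _ _ (Finset.mem_univ i),
      ← Finset.mul_prod_erase _ (fun j => E.hg.single (E.rep (S.erase i) j)) (Finset.mem_univ i),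
      E.rep_eq_q_iff.2 hS]
    have h0 : E.rep (S.erase i) i = E.hg.e := by simp [rep]
    rw [h0, single_e, one_mul]
    congr 1
    refine Finset.prod_congr rfl fun j hj => ?_
    simp [rep, Finset.ne_of_mem_erase hj]
  have h1 : E.elt S ∈ E.hg.hmul (E.q i) (E.elt (S.erase i)) := by
    rw [← mem_single_mul_single, ← hS']; rfl
  rw [E.hg.h3l, star_eq_s3, h, ← mem_single_mul_single, single_elt_mul_single_elt,
    ← Finset.mul_prod_erase _ _ (Finset.mem_univ i)] at h1
  have h0 : E.hg.single (E.rep T i) * E.hg.single (E.rep (S.erase i) i) = 1 := by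
    simp [rep, hT, single_e]
  rw [h0, one_mul, mem_prod] at h1
  obtain ⟨r, hr, hq⟩ := h1
  have hc : E.q i ∈ E.hg.cofactor E.fam i := by
    rw [cofactor_eq_prod]
    refine mem_prod.2 ⟨r, fun j hj => ?_, hq⟩
    have hj := (mem_single_mul_single _).1 (hr j hj)
    have hcl : E.hg.IsClosed (E.fam j) := (E.dp.1 j).1
    refine hcl.2 ⟨_, ⟨_, E.rep_mem_fam T j, E.star_eq_s3 _⟩, _, E.rep_mem_fam _ j, hj⟩
  have : E.q i ∈ ({E.hg.e} : Set H) :=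
    E.fam_inter_cofactor i ▸ ⟨E.mem_fam.2 (Or.inr rfl), hc⟩
  exact (E.invol i).1 this

lemma elt_injective : Function.Injective E.elt := fun _ _ h =>
  (subset_of_elt_eq h).antisymm (subset_of_elt_eq h.symm)

variable {E} in
lemma elt_mem_hmul {S T U : Finset (Fin E.n)} :
    E.elt U ∈ E.hg.hmul (E.elt S) (E.elt T) ↔
      ∀ i, (i ∈ U → (i ∈ S ∨ i ∈ T) ∧ (i ∈ S → i ∈ T → E.hg.IsThick (E.q i))) ∧
        (i ∉ U → (i ∈ S ↔ i ∈ T)) := by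
  simp only [← rep_mem_hmul]
  rw [← mem_single_mul_single, single_elt_mul_single_elt, mem_prod]
  simp only [mem_single_mul_single, Finset.mem_univ, forall_const]
  constructor
  · rintro ⟨r, hr, hU⟩
    have hfam : ∀ i, r i ∈ E.fam i := fun i =>
      ((E.dp.1 i).1 : E.hg.IsClosed (E.fam i)).2
        ⟨_, ⟨_, E.rep_mem_fam S i, E.star_eq_s3 _⟩, _, E.rep_mem_fam T i, hr i⟩
    obtain ⟨V, rfl⟩ := exists_rep_eq hfam
    rw [prod_rep, mem_single] at hU
    rwa [E.elt_injective hU]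
  · intro h
    exact ⟨E.rep U, h, by rw [prod_rep]; rfl⟩

lemma support_elt (S : Finset (Fin E.n)) : E.support (E.elt S) = E.q '' S := by
  ext y
  constructor
  · rintro ⟨hy, r, ⟨hr, hS⟩, i, rfl⟩
    obtain ⟨T, rfl⟩ := exists_rep_eq hr
    rw [famProd_eq_prod, prod_rep] at hS
    obtain rfl := E.elt_injective hS
    by_cases hi : i ∈ S
    · exact ⟨i, hi, (E.rep_eq_q_iff.2 hi).symm⟩
    · simp [rep, hi] at hy
  · rintro ⟨i, hi, rfl⟩
    refine ⟨(E.invol i).1, E.rep S, ⟨E.rep_mem_fam S, ?_⟩, i, E.rep_eq_q_iff.2 hi⟩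
    rw [famProd_eq_prod, prod_rep]
    rfl

variable {E} in
lemma elt_mem_thickIn {G : Set H} {S : Finset (Fin E.n)} :
    E.elt S ∈ E.ThickIn G ↔ E.elt S ∈ G ∧ ∀ i ∈ S, E.hg.IsThick (E.q i) := by
  rw [ThickIn, Set.mem_sep_iff, support_elt, Set.forall_mem_image, ← elt_empty,
    E.elt_injective.eq_iff]
  refine and_congr_right fun _ => or_iff_right_of_imp ?_
  rintro rfl
  simp

variable {E} in
lemma elt_mem_thinIn {G : Set H} {S : Finset (Fin E.n)} :
    E.elt S ∈ E.ThinIn G ↔ E.elt S ∈ G ∧ ∀ i ∈ S, ¬ E.hg.IsThick (E.q i) := by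
  simp only [IsThick, not_not]
  rw [ThinIn, Set.mem_sep_iff, support_elt, Set.forall_mem_image, ← elt_empty,
    E.elt_injective.eq_iff]
  refine and_congr_right fun _ => or_iff_right_of_imp ?_
  rintro rfl
  simp

variable {E} in
lemma isClosed_iff {G : Set H} : E.hg.IsClosed G ↔
    E.hg.e ∈ G ∧ ∀ S T U, E.elt S ∈ G → E.elt T ∈ G →
      E.elt U ∈ E.hg.hmul (E.elt S) (E.elt T) → E.elt U ∈ G := by
  constructor
  · intro hG
    exact ⟨hG.e_mem, fun S T U hS hT hU => hG.2 ⟨_, ⟨_, hS, E.star_eq_s3 _⟩, _, hT, hU⟩⟩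
  · rintro ⟨he, h⟩
    refine ⟨⟨_, he⟩, ?_⟩
    rintro x ⟨_, ⟨y, hy, rfl⟩, z, hz, hx⟩
    rw [star_eq_s3] at hx
    obtain ⟨S, rfl⟩ := E.elt_surjective y
    obtain ⟨T, rfl⟩ := E.elt_surjective z
    obtain ⟨U, rfl⟩ := E.elt_surjective x
    exact h S T U hy hz hx

variable {E} {G : Set H}

lemma isClosed_thickIn (hG : E.hg.IsClosed G) : E.hg.IsClosed (E.ThickIn G) := by
  rw [isClosed_iff] at hG ⊢
  refine ⟨⟨hG.1, Or.inl rfl⟩, fun S T U hS hT hU => ?_⟩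
  rw [elt_mem_thickIn] at hS hT ⊢
  refine ⟨hG.2 S T U hS.1 hT.1 hU, fun i hi => ?_⟩
  exact ((elt_mem_hmul.1 hU i).1 hi).1.elim (hS.2 i) (hT.2 i)

lemma isClosed_thinIn (hG : E.hg.IsClosed G) : E.hg.IsClosed (E.ThinIn G) := by
  rw [isClosed_iff] at hG ⊢
  refine ⟨⟨hG.1, Or.inl rfl⟩, fun S T U hS hT hU => ?_⟩
  rw [elt_mem_thinIn] at hS hT ⊢
  refine ⟨hG.2 S T U hS.1 hT.1 hU, fun i hi => ?_⟩
  exact ((elt_mem_hmul.1 hU i).1 hi).1.elim (hS.2 i) (hT.2 i)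

open Classical in
lemma elt_filter_thick_mem (hG : E.hg.IsClosed G) {S : Finset (Fin E.n)} (hS : E.elt S ∈ G) :
    E.elt {i ∈ S | E.hg.IsThick (E.q i)} ∈ E.ThickIn G := by
  rw [elt_mem_thickIn]
  refine ⟨(isClosed_iff.1 hG).2 S S _ hS hS (elt_mem_hmul.2 fun i => ?_), by simp⟩
  simp only [Finset.mem_filter]
  tauto

open Classical in
lemma elt_filter_thin_mem (hG : E.hg.IsClosed G) {S : Finset (Fin E.n)} (hS : E.elt S ∈ G) :
    E.elt {i ∈ S | ¬ E.hg.IsThick (E.q i)} ∈ E.ThinIn G := by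
  rw [elt_mem_thinIn]
  refine ⟨(isClosed_iff.1 hG).2 S _ _ hS (elt_filter_thick_mem hG hS).1
    (elt_mem_hmul.2 fun i => ?_), by simp⟩
  simp only [Finset.mem_filter]
  tauto

lemma elt_mem_hmul_thick_thin {S T U : Finset (Fin E.n)}
    (hS : ∀ i ∈ S, E.hg.IsThick (E.q i)) (hT : ∀ i ∈ T, ¬ E.hg.IsThick (E.q i)) :
    E.elt U ∈ E.hg.hmul (E.elt S) (E.elt T) ↔ U = S ∪ T := by
  rw [elt_mem_hmul, Finset.ext_iff]
  refine forall_congr' fun i => ?_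
  have := hS i
  have := hT i
  rw [Finset.mem_union]
  tauto

open Classical in
lemma smul_thickIn_thinIn (hG : E.hg.IsClosed G) :
    E.hg.smul (E.ThickIn G) (E.ThinIn G) = G := by
  ext x
  constructor
  · rintro ⟨y, hy, z, hz, hx⟩
    exact hG.2 ⟨y, ⟨y, hy.1, E.star_eq_s3 y⟩, z, hz.1, hx⟩
  · intro hx
    obtain ⟨S, rfl⟩ := E.elt_surjective x
    refine ⟨_, elt_filter_thick_mem hG hx, _, elt_filter_thin_mem hG hx, ?_⟩
    rw [elt_mem_hmul_thick_thin (by simp) (by simp), Finset.filter_union_filter_not_eq]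

open Classical in
lemma ncard_eq_mul (hG : E.hg.IsClosed G) :
    G.ncard = (E.ThickIn G).ncard * (E.ThinIn G).ncard := by
  set φ : Finset (Fin E.n) → H × H := fun S =>
    (E.elt {i ∈ S | E.hg.IsThick (E.q i)}, E.elt {i ∈ S | ¬ E.hg.IsThick (E.q i)}) with hφ
  have hφ_inj : Function.Injective φ := by
    intro S T h
    rw [← Finset.filter_union_filter_not_eq (fun i => E.hg.IsThick (E.q i)) S,
      ← Finset.filter_union_filter_not_eq (fun i => E.hg.IsThick (E.q i)) T,
      E.elt_injective (Prod.ext_iff.1 h).1, E.elt_injective (Prod.ext_iff.1 h).2]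
  have himage : φ '' (E.elt ⁻¹' G) = E.ThickIn G ×ˢ E.ThinIn G := by
    ext ⟨y, z⟩
    constructor
    · rintro ⟨S, hS, h⟩
      rw [← h]
      exact ⟨elt_filter_thick_mem hG hS, elt_filter_thin_mem hG hS⟩
    · rintro ⟨hy, hz⟩
      obtain ⟨S, rfl⟩ := E.elt_surjective y
      obtain ⟨T, rfl⟩ := E.elt_surjective z
      obtain ⟨hSG, hS⟩ := elt_mem_thickIn.1 hy
      obtain ⟨hTG, hT⟩ := elt_mem_thinIn.1 hz
      refine ⟨S ∪ T, (isClosed_iff.1 hG).2 S T _ hSG hTG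
        ((elt_mem_hmul_thick_thin hS hT).2 rfl), ?_⟩
      simp only [hφ, Finset.filter_union]
      rw [Finset.filter_true_of_mem hS, Finset.filter_false_of_mem hT,
        Finset.filter_false_of_mem fun i hi => not_not.2 (hS i hi), Finset.filter_true_of_mem hT,
        Finset.union_empty, Finset.empty_union]
  rw [← Set.ncard_prod, ← himage, Set.ncard_image_of_injective _ hφ_inj,
    ← Set.ncard_image_of_injective _ E.elt_injective,
    Set.image_preimage_eq _ E.elt_surjective]

end EA2Data

end HyperPaper

/-- For a closed subset G of an elementary abelian 2-hypergroup:
Thick(G) and Thin(G) are closed subsets of H, and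
|G| = |Thick(G)·Thin(G)| = |Thick(G)|·|Thin(G)|. -/
theorem stmt3 {H : Type*} (E : EA2Data H) (G : Set H) (hG : E.hg.IsClosed G) :
    E.hg.IsClosed (E.ThickIn G) ∧ E.hg.IsClosed (E.ThinIn G) ∧
      G.ncard = (E.hg.smul (E.ThickIn G) (E.ThinIn G)).ncard ∧
      G.ncard = (E.ThickIn G).ncard * (E.ThinIn G).ncard :=
  ⟨EA2Data.isClosed_thickIn hG, EA2Data.isClosed_thinIn hG,
    by rw [EA2Data.smul_thickIn_thinIn hG], EA2Data.ncard_eq_mul hG⟩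
end
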